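/- arXiv:1101.2305 — 2 statements merged into one kernel-verified Lean document; each statement's English description precedes it below -/
import Mathlib

section
/- Let n be a positive integer and let Z ⊂ ℝ² = ℂ denote the set of n-th roots of unity. Let x_1, …, x_n : [0, 1) → ℝ² be continuous functions such that x_1(t), …, x_n(t) are pairwise distinct for each t, and set S_t := {x_1(t), …, x_n(t)}. Then there exists a map Φ : [0, 1) × ℝ² → ℝ² such that: (i) for each t ∈ [0, 1), Φ_t := Φ(t, ·) is a homeomorphism of ℝ² onto itself; (ii) Φ and the map (t, y) ↦ Φ_t^{−1}(y) are jointly continuous on [0, 1) × ℝ²; (iii) for each t there is a compact subset of ℝ² outside of which Φ_t is the identity; and (iv) Φ_t(S_t) = Z for all t ∈ [0, 1). -/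
open Set

/-- A jointly continuous family of compactly supported homeomorphisms, with jointly continuous
inverses. -/
structure IsIsotopy (F : ℝ → ℂ ≃ₜ ℂ) : Prop where
  continuous_apply : Continuous fun q : ℝ × ℂ => F q.1 q.2
  continuous_symm_apply : Continuous fun q : ℝ × ℂ => (F q.1).symm q.2
  compact_support : ∀ s, ∃ K : Set ℂ, IsCompact K ∧ ∀ y ∉ K, F s y = y

namespace IsIsotopy

variable {F G : ℝ → ℂ ≃ₜ ℂ}

theorem refl : IsIsotopy fun _ => Homeomorph.refl ℂ :=
  ⟨continuous_snd, continuous_snd, fun _ => ⟨∅, isCompact_empty, fun _ _ => rfl⟩⟩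

theorem symm (hF : IsIsotopy F) : IsIsotopy fun s => (F s).symm where
  continuous_apply := hF.continuous_symm_apply
  continuous_symm_apply := hF.continuous_apply
  compact_support s := by
    obtain ⟨K, hK, h⟩ := hF.compact_support s
    exact ⟨K, hK, fun y hy => (Homeomorph.symm_apply_eq _).2 (h y hy).symm⟩

theorem trans (hF : IsIsotopy F) (hG : IsIsotopy G) :
    IsIsotopy fun s => (F s).trans (G s) where
  continuous_apply := hG.continuous_apply.comp (continuous_fst.prodMk hF.continuous_apply)
  continuous_symm_apply :=
    hF.continuous_symm_apply.comp (continuous_fst.prodMk hG.continuous_symm_apply)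
  compact_support s := by
    obtain ⟨K, hK, h⟩ := hF.compact_support s
    obtain ⟨L, hL, h'⟩ := hG.compact_support s
    refine ⟨K ∪ L, hK.union hL, fun y hy => ?_⟩
    rw [mem_union, not_or] at hy
    rw [Homeomorph.trans_apply, h y hy.1, h' y hy.2]

theorem comp (hF : IsIsotopy F) {g : ℝ → ℝ} (hg : Continuous g) :
    IsIsotopy fun s => F (g s) where
  continuous_apply :=
    hF.continuous_apply.comp ((hg.comp continuous_fst).prodMk continuous_snd)
  continuous_symm_apply :=
    hF.continuous_symm_apply.comp ((hg.comp continuous_fst).prodMk continuous_snd)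
  compact_support s := hF.compact_support (g s)

end IsIsotopy

theorem continuous_symm_of_uniform_antilipschitz {T E : Type*} [TopologicalSpace T]
    [PseudoMetricSpace E] (F : T → E ≃ₜ E) (hF : Continuous fun q : T × E => F q.1 q.2)
    {C : ℝ} (hC : ∀ t y z, dist y z ≤ C * dist (F t y) (F t z)) :
    Continuous fun q : T × E => (F q.1).symm q.2 := by
  rw [continuous_iff_continuousAt]
  rintro ⟨t₀, w₀⟩
  rw [ContinuousAt, tendsto_iff_dist_tendsto_zero]
  set z := (F t₀).symm w₀ with hz
  have hlim : Filter.Tendsto (fun q : T × E => C * dist q.2 (F q.1 z)) (nhds (t₀, w₀))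
      (nhds 0) := by
    have : Continuous fun q : T × E => C * dist q.2 (F q.1 z) :=
      continuous_const.mul (continuous_snd.dist (hF.comp (continuous_fst.prodMk continuous_const)))
    simpa [hz] using this.tendsto (t₀, w₀)
  refine squeeze_zero (fun _ => dist_nonneg) (fun q => ?_) hlim
  simpa using hC q.1 ((F q.1).symm q.2) z

theorem exists_homeomorph_id_add_of_lipschitz {E : Type*} [NormedAddCommGroup E]
    [NormedSpace ℝ E] [CompleteSpace E] {g : E → E}
    (hg : ∀ y z, ‖g y - g z‖ ≤ 1 / 2 * ‖y - z‖) :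
    ∃ h : E ≃ₜ E, ∀ y, h y = y + g y := by
  have happ : ApproximatesLinearOn (fun y => y + g y)
      ((ContinuousLinearEquiv.refl ℝ E : E ≃L[ℝ] E) : E →L[ℝ] E) univ (1 / 2) := by
    intro y _ z _
    have := hg y z
    simpa [add_sub_add_comm] using this
  have hc : Subsingleton E ∨
      (1 / 2 : NNReal) < ‖((ContinuousLinearEquiv.refl ℝ E).symm : E →L[ℝ] E)‖₊⁻¹ := by
    rcases subsingleton_or_nontrivial E with h | h
    · exact Or.inl h
    · right
      have : ‖((ContinuousLinearEquiv.refl ℝ E).symm : E →L[ℝ] E)‖₊ = 1 :=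
        ContinuousLinearMap.nnnorm_id
      rw [this, inv_one]
      exact NNReal.half_lt_self one_ne_zero
  exact ⟨happ.toHomeomorph _ hc, fun _ => rfl⟩

theorem Function.Injective.exists_separation {ι : Type*} [Finite ι] {p : ι → ℂ}
    (hp : Function.Injective p) : ∃ δ > 0, ∀ i j, i ≠ j → δ ≤ ‖p i - p j‖ := by
  have h : ∀ᶠ δ in nhdsWithin (0 : ℝ) (Ioi 0), ∀ i j, i ≠ j → δ ≤ ‖p i - p j‖ := by
    simp only [Filter.eventually_all]
    intro i j hij
    exact nhdsWithin_le_nhds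
      (eventually_le_nhds (norm_pos_iff.2 (sub_ne_zero.2 (hp.ne hij))))
  obtain ⟨δ, h, hδ⟩ := (h.and self_mem_nhdsWithin).exists
  exact ⟨δ, hδ, h⟩

theorem exists_isotopy_of_near {n : ℕ} {p : Fin n → ℂ} (hp : Function.Injective p) :
    ∃ ε > 0, ∀ Y : ℝ → Fin n → ℂ, Continuous Y → (∀ s i, ‖Y s i - p i‖ ≤ ε) →
      ∃ F, IsIsotopy F ∧ ∀ s i, F s (p i) = Y s i := by
  obtain ⟨δ, hδ, hsep⟩ := hp.exists_separation
  refine ⟨δ / (2 * (n + 1)), by positivity, fun Y hY hYp => ?_⟩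
  set ε := δ / (2 * (n + 1)) with hε
  let φ : ℂ → ℝ := fun y => max 0 (1 - ‖y‖ / δ)
  have hφc : Continuous φ := by fun_prop
  have hφ0 : φ 0 = 1 := by simp [φ]
  have hφfar : ∀ y, δ ≤ ‖y‖ → φ y = 0 := fun y hy =>
    max_eq_left (sub_nonpos.2 ((one_le_div hδ).2 hy))
  have hφlip : ∀ y z, |φ y - φ z| ≤ ‖y - z‖ / δ := by
    intro y z
    calc |φ y - φ z| ≤ |(1 - ‖y‖ / δ) - (1 - ‖z‖ / δ)| := by
          simpa using abs_max_sub_max_le_max 0 (1 - ‖y‖ / δ) 0 (1 - ‖z‖ / δ)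
      _ = |‖z‖ - ‖y‖| / δ := by
          rw [← abs_of_pos hδ, ← abs_div, abs_of_pos hδ]; congr 1; ring
      _ ≤ ‖y - z‖ / δ := by
          gcongr
          rw [norm_sub_rev]
          exact abs_norm_sub_norm_le z y
  let g : ℝ → ℂ → ℂ := fun s y => ∑ i, (φ (y - p i) : ℂ) * (Y s i - p i)
  have hg : ∀ s y z, ‖g s y - g s z‖ ≤ 1 / 2 * ‖y - z‖ := by
    intro s y z
    calc ‖g s y - g s z‖
        = ‖∑ i, ((φ (y - p i) - φ (z - p i) : ℝ) : ℂ) * (Y s i - p i)‖ := by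
          simp only [g, ← Finset.sum_sub_distrib, ← sub_mul, Complex.ofReal_sub]
      _ ≤ ∑ _i : Fin n, ‖y - z‖ / δ * ε := by
          refine norm_sum_le_of_le _ fun i _ => ?_
          rw [norm_mul, Complex.norm_real, Real.norm_eq_abs]
          have := hφlip (y - p i) (z - p i)
          rw [sub_sub_sub_cancel_right] at this
          exact mul_le_mul this (hYp s i) (norm_nonneg _) (by positivity)
      _ = n / (n + 1) * (1 / 2 * ‖y - z‖) := by
          rw [Finset.sum_const, Finset.card_univ, Fintype.card_fin, nsmul_eq_mul, hε]
          field_simp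
      _ ≤ 1 * (1 / 2 * ‖y - z‖) := by
          gcongr
          exact (div_le_one (by positivity)).2 (by linarith)
      _ = 1 / 2 * ‖y - z‖ := one_mul _
  choose F hF using fun s => exists_homeomorph_id_add_of_lipschitz (hg s)
  have hFc : Continuous fun q : ℝ × ℂ => F q.1 q.2 := by
    simp only [hF, g]
    fun_prop
  refine ⟨F, ⟨hFc, continuous_symm_of_uniform_antilipschitz F hFc (C := 2) fun s y z => ?_,
    fun s => ⟨⋃ i, Metric.closedBall (p i) δ,
      isCompact_iUnion fun i => isCompact_closedBall _ _, fun y hy => ?_⟩⟩, fun s i => ?_⟩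
  · rw [dist_eq_norm, dist_eq_norm, hF, hF, add_sub_add_comm]
    have h1 := hg s y z
    have h2 := norm_sub_le_norm_add (y - z) (g s y - g s z)
    linarith
  · rw [hF, add_eq_left]
    refine Finset.sum_eq_zero fun i _ => ?_
    rw [hφfar, Complex.ofReal_zero, zero_mul]
    by_contra hlt
    exact hy (mem_iUnion.2 ⟨i, mem_closedBall_iff_norm.2 (not_le.1 hlt).le⟩)
  · rw [hF]
    have : g s (p i) = Y s i - p i := by
      simp only [g]
      rw [Finset.sum_eq_single i]
      · simp [hφ0]
      · intro j _ hj
        rw [hφfar _ (hsep i j hj.symm), Complex.ofReal_zero, zero_mul]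
      · simp
    rw [this, add_sub_cancel]

/-- On `[a, b]` the moving configuration `X` is followed by an isotopy that is the identity up to
time `a`. -/
def IsFollowedOn {n : ℕ} (X : ℝ → Fin n → ℂ) (a b : ℝ) : Prop :=
  ∃ F, IsIsotopy F ∧ (∀ s ≤ a, F s = Homeomorph.refl ℂ) ∧
    ∀ s i, F s (X a i) = X (max a (min b s)) i

namespace IsFollowedOn

variable {n : ℕ} {X : ℝ → Fin n → ℂ}

theorem refl (a : ℝ) : IsFollowedOn X a a :=
  ⟨_, IsIsotopy.refl, fun _ _ => rfl, fun s i => by simp⟩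

theorem trans {a b c : ℝ} (hab : a ≤ b) (hbc : b ≤ c) (h₁ : IsFollowedOn X a b)
    (h₂ : IsFollowedOn X b c) : IsFollowedOn X a c := by
  obtain ⟨F, hF, hF0, hFX⟩ := h₁
  obtain ⟨G, hG, hG0, hGX⟩ := h₂
  refine ⟨_, hF.trans hG, fun s hs => ?_, fun s i => ?_⟩
  · rw [hF0 s hs, hG0 s (hs.trans hab)]
    rfl
  · rw [Homeomorph.trans_apply, hFX]
    rcases le_total s b with hs | hs
    · rw [hG0 s hs, min_eq_right hs, min_eq_right (hs.trans hbc)]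
      rfl
    · rw [min_eq_left hs, max_eq_right hab, hGX, max_eq_right (le_min hbc hs),
        max_eq_right (hab.trans (le_min hbc hs))]

theorem of_local (hX : Continuous X) (hinj : ∀ s, Function.Injective (X s)) (s₀ : ℝ) :
    ∃ U : Set ℝ, IsOpen U ∧ s₀ ∈ U ∧ ∀ a b, a ≤ b → Icc a b ⊆ U → IsFollowedOn X a b := by
  obtain ⟨ε, hε, h⟩ := exists_isotopy_of_near (hinj s₀)
  refine ⟨X ⁻¹' Metric.ball (X s₀) ε, Metric.isOpen_ball.preimage hX, by simpa, fun a b hab hU => ?_⟩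
  have hmem : ∀ s, max a (min b s) ∈ Icc a b := fun s =>
    ⟨le_max_left _ _, max_le hab (min_le_left _ _)⟩
  obtain ⟨F, hF, hFX⟩ := h (fun s => X (max a (min b s))) (by fun_prop) fun s i => by
    have := hU (hmem s)
    rw [mem_preimage, mem_ball_iff_norm] at this
    exact (norm_le_pi_norm (X _ - X s₀) i).trans this.le
  have hFa : ∀ i, F a (X s₀ i) = X a i := fun i => by
    rw [hFX, min_eq_right hab, max_self]
  refine ⟨_, (hF.comp (continuous_const (y := a))).symm.trans
    (hF.comp (g := fun s => max a s) (by fun_prop)), fun s hs => ?_, fun s i => ?_⟩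
  · rw [max_eq_left hs]
    exact Homeomorph.symm_trans_self _
  · rw [Homeomorph.trans_apply, ← hFa, Homeomorph.symm_apply_apply, hFX]
    congr 1
    rcases le_total a s with hs | hs
    · rw [max_eq_right hs]
    · rw [max_eq_left hs, min_eq_right hab, min_eq_right (hs.trans hab), max_self, max_eq_left hs]

theorem of_le (hX : Continuous X) (hinj : ∀ s, Function.Injective (X s)) {a b : ℝ}
    (hab : a ≤ b) : IsFollowedOn X a b := by
  choose U hUo hU hUX using of_local hX hinj
  obtain ⟨t, ht0, htm, ⟨m, hm⟩, ht⟩ := exists_monotone_Icc_subset_open_cover_Icc hab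
    (c := fun s => Subtype.val ⁻¹' U s) (fun s => (hUo s).preimage continuous_subtype_val)
    fun y _ => mem_iUnion.2 ⟨y, hU y⟩
  have key : ∀ k, IsFollowedOn X a (t k) := by
    intro k
    induction k with
    | zero => rw [ht0]; exact refl a
    | succ k ih =>
      have hle : (t k : ℝ) ≤ t (k + 1) := htm k.le_succ
      refine trans (t k).2.1 hle ih ?_
      obtain ⟨s, hs⟩ := ht k
      refine hUX s _ _ hle fun y hy => ?_
      exact hs (show (⟨y, (t k).2.1.trans hy.1, hy.2.trans (t (k + 1)).2.2⟩ : Icc a b) ∈ _ from hy)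
  simpa [hm m le_rfl] using key m

end IsFollowedOn

theorem exists_isotopy_follow {n : ℕ} {X : ℝ → Fin n → ℂ} (hX : Continuous X)
    (hinj : ∀ s, Function.Injective (X s)) :
    ∃ F, IsIsotopy F ∧ ∀ s, 0 ≤ s → ∀ i, F s (X 0 i) = X s i := by
  choose G hG hG0 hGX using fun m : ℕ =>
    IsFollowedOn.of_le hX hinj (show (m : ℝ) ≤ m + 1 by linarith)
  let C : ℕ → ℝ → ℂ ≃ₜ ℂ := fun m =>
    Nat.rec (fun _ => Homeomorph.refl ℂ) (fun k f s => (f s).trans (G k s)) m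
  have hCsucc : ∀ k s, C (k + 1) s = (C k s).trans (G k s) := fun _ _ => rfl
  have hC : ∀ m, IsIsotopy (C m) := by
    intro m
    induction m with
    | zero => exact IsIsotopy.refl
    | succ k ih => exact ih.trans (hG k)
  have hCX : ∀ m s i, C m s (X 0 i) = X (max 0 (min m s)) i := by
    intro m s i
    induction m with
    | zero => simp [C]
    | succ k ih =>
      rw [hCsucc, Homeomorph.trans_apply, ih]
      have hk : (0 : ℝ) ≤ k := k.cast_nonneg
      push_cast
      rcases le_total s k with hs | hs
      · rw [hG0 k s hs, min_eq_right hs, min_eq_right (by linarith)]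
        rfl
      · have : (k : ℝ) ≤ min ((k : ℝ) + 1) s := le_min (by linarith : (k : ℝ) ≤ k + 1) hs
        rw [min_eq_left hs, max_eq_right hk, hGX, max_eq_right this, max_eq_right (hk.trans this)]
  have hstable : ∀ {l m : ℕ} {s : ℝ}, l ≤ m → s ≤ l → C m s = C l s := by
    intro l m s hlm hs
    induction m, hlm using Nat.le_induction with
    | base => rfl
    | succ k hk ih =>
      rw [hCsucc, ih, hG0 k s (hs.trans (by exact_mod_cast hk))]
      rfl
  have hloc : ∀ q : ℝ × ℂ, ∃ m : ℕ, ∀ᶠ r in nhds q, C ⌈r.1⌉₊ r.1 = C m r.1 := by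
    intro q
    refine ⟨⌈q.1⌉₊ + 1, ?_⟩
    have hq : q.1 < (⌈q.1⌉₊ + 1 : ℕ) := by
      push_cast
      linarith [Nat.le_ceil q.1]
    filter_upwards [continuous_fst.continuousAt.eventually_lt continuousAt_const hq] with r hr
    exact (hstable (Nat.ceil_le.2 hr.le) (Nat.le_ceil _)).symm
  refine ⟨fun s => C ⌈s⌉₊ s, ⟨?_, ?_, fun s => (hC _).compact_support s⟩, fun s hs i => ?_⟩
  · refine continuous_iff_continuousAt.2 fun q => ?_
    obtain ⟨m, hm⟩ := hloc q
    exact (hC m).continuous_apply.continuousAt.congr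
      (hm.mono fun r hr => by simp only [hr])
  · refine continuous_iff_continuousAt.2 fun q => ?_
    obtain ⟨m, hm⟩ := hloc q
    exact (hC m).continuous_symm_apply.continuousAt.congr
      (hm.mono fun r hr => by simp only [hr])
  · rw [hCX, min_eq_right (Nat.le_ceil s), max_eq_right hs]

theorem exists_compactlySupported_homeomorph {n : ℕ} {p q : Fin n → ℂ}
    (hp : Function.Injective p) (hq : Function.Injective q) :
    ∃ h : ℂ ≃ₜ ℂ, (∃ K : Set ℂ, IsCompact K ∧ ∀ y ∉ K, h y = y) ∧ ∀ i, h (p i) = q i := by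
  -- The straight-line motion with a complex time parameter has collisions at finitely many times.
  let B : Set ℂ := ⋃ i, ⋃ j, {z | i ≠ j ∧ p i + z * (q i - p i) = p j + z * (q j - p j)}
  have hB : B.Countable := by
    refine countable_iUnion fun i => countable_iUnion fun j => Subsingleton.countable ?_
    rintro z ⟨hij, hz⟩ w ⟨-, hw⟩
    have hne : p i - p j ≠ 0 := sub_ne_zero.2 (hp.ne hij)
    have hzw : (z - w) * (p i - p j) = 0 := by
      linear_combination z * hw - w * hz
    exact sub_eq_zero.1 ((mul_eq_zero.1 hzw).resolve_right hne)
  have hmem : ∀ {z}, z ∈ Bᶜ ↔ Function.Injective fun i => p i + z * (q i - p i) := by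
    intro z
    simp only [B, mem_compl_iff, mem_iUnion, mem_ofPred_eq, not_exists, not_and]
    exact ⟨fun h i j hij => by_contra fun hne => h i j hne hij, fun h i j hij he => hij (h he)⟩
  have h0 : (0 : ℂ) ∈ Bᶜ := hmem.2 (by simpa using hp)
  have h1 : (1 : ℂ) ∈ Bᶜ := hmem.2 (by simpa using hq)
  obtain ⟨γ, hγ⟩ := (hB.isPathConnected_compl_of_one_lt_rank
    (by rw [Complex.rank_real_complex]; norm_num)).joinedIn 0 h0 1 h1
  have hmemγ : ∀ s, γ.extend s ∈ Bᶜ := fun s => hγ _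
  obtain ⟨F, hF, hFX⟩ := exists_isotopy_follow
    (X := fun s i => p i + γ.extend s * (q i - p i))
    (continuous_pi fun i => continuous_const.add (γ.continuous_extend.mul continuous_const))
    fun s => hmem.1 (hmemγ s)
  refine ⟨F 1, hF.compact_support 1, fun i => ?_⟩
  simpa using hFX 1 zero_le_one i

theorem Complex.exists_enum_rootsOfUnity {n : ℕ} (hn : 0 < n) :
    ∃ q : Fin n → ℂ, Function.Injective q ∧ range q = {z | z ^ n = 1} := by
  have hζ := Complex.isPrimitiveRoot_exp n hn.ne'
  refine ⟨fun i => Complex.exp (2 * Real.pi * Complex.I / n) ^ (i : ℕ), fun i j hij =>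
    Fin.ext (hζ.pow_inj i.2 j.2 hij), Subset.antisymm ?_ fun z hz => ?_⟩
  · rintro _ ⟨i, rfl⟩
    rw [mem_ofPred_eq, pow_right_comm, hζ.pow_eq_one, one_pow]
  · have : NeZero n := ⟨hn.ne'⟩
    obtain ⟨i, hi, h⟩ := hζ.eq_pow_of_pow_eq_one hz
    exact ⟨⟨i, hi⟩, h⟩

/-- The map `t ↦ t / (1 - t)` from `[0, 1)` to `[0, ∞)` has a left inverse that extends
continuously to the real line. -/
theorem exists_continuous_leftInverse_div_one_sub :
    ∃ g : ℝ → ℝ, Continuous g ∧ (∀ s, g s ∈ Ico (0 : ℝ) 1) ∧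
      ∀ t ∈ Ico (0 : ℝ) 1, 0 ≤ t / (1 - t) ∧ g (t / (1 - t)) = t := by
  have hpos : ∀ s : ℝ, 0 < 1 + max s 0 := fun s => by linarith [le_max_right s 0]
  refine ⟨fun s => max s 0 / (1 + max s 0),
    Continuous.div (by fun_prop) (by fun_prop) fun s => (hpos s).ne',
    fun s => ⟨div_nonneg (le_max_right _ _) (hpos s).le, (div_lt_one (hpos s)).2 (by linarith)⟩,
    ?_⟩
  rintro t ⟨h0, h1⟩
  have h1' : 0 < 1 - t := by linarith
  have hnn : 0 ≤ t / (1 - t) := div_nonneg h0 h1'.le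
  refine ⟨hnn, ?_⟩
  simp only [max_eq_left hnn]
  field_simp
  ring

/-- Given a continuous one-parameter family `S_t = {x₁(t), …, x_n(t)}`, `0 ≤ t < 1`,
of sets of `n` distinct points in the plane `ℝ² = ℂ`, there is a continuous
one-parameter family `Φ_t` of compactly supported homeomorphisms of the plane with
`Φ_t(S_t) = Z`, the set of `n`-th roots of unity. -/
theorem untangle_points_in_plane (n : ℕ) (hn : 0 < n) (x : Fin n → ℝ → ℂ)
    (hcont : ∀ i, ContinuousOn (x i) (Set.Ico 0 1))
    (hdist : ∀ t ∈ Set.Ico (0 : ℝ) 1, ∀ i j, i ≠ j → x i t ≠ x j t) :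
    ∃ Φ Ψ : ℝ → ℂ → ℂ,
      ContinuousOn (fun q : ℝ × ℂ => Φ q.1 q.2) (Set.Ico 0 1 ×ˢ Set.univ) ∧
      ContinuousOn (fun q : ℝ × ℂ => Ψ q.1 q.2) (Set.Ico 0 1 ×ˢ Set.univ) ∧
      (∀ t ∈ Set.Ico (0 : ℝ) 1,
        Function.LeftInverse (Ψ t) (Φ t) ∧ Function.RightInverse (Ψ t) (Φ t)) ∧
      (∀ t ∈ Set.Ico (0 : ℝ) 1, ∃ K : Set ℂ, IsCompact K ∧ ∀ y ∉ K, Φ t y = y) ∧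
      (∀ t ∈ Set.Ico (0 : ℝ) 1,
        Φ t '' {z : ℂ | ∃ i, z = x i t} = {z : ℂ | z ^ n = 1}) := by
  obtain ⟨g, hg, hgmem, hginv⟩ := exists_continuous_leftInverse_div_one_sub
  have hinj : ∀ s, Function.Injective fun i => x i (g s) := fun s i j hij =>
    by_contra fun hne => hdist _ (hgmem s) i j hne hij
  obtain ⟨F, hF, hFX⟩ := exists_isotopy_follow (X := fun s i => x i (g s))
    (continuous_pi fun i => (hcont i).comp_continuous hg hgmem) hinj
  obtain ⟨q, hq, hqr⟩ := Complex.exists_enum_rootsOfUnity hn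
  obtain ⟨h, hsupp, hhq⟩ := exists_compactlySupported_homeomorph (hinj 0) hq
  have hH : IsIsotopy fun _ => h :=
    ⟨h.continuous.comp continuous_snd, h.symm.continuous.comp continuous_snd, fun _ => hsupp⟩
  have hD := hF.symm.trans hH
  have htime : ContinuousOn (fun r : ℝ × ℂ => (r.1 / (1 - r.1), r.2)) (Ico 0 1 ×ˢ univ) :=
    (continuousOn_fst.div (continuousOn_const.sub continuousOn_fst)
      fun r hr => (sub_pos.2 hr.1.2).ne').prodMk continuousOn_snd
  have hΦ := hD.continuous_apply.comp_continuousOn htime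
  have hΨ := hD.continuous_symm_apply.comp_continuousOn htime
  refine ⟨fun t => (F (t / (1 - t))).symm.trans h, fun t => ((F (t / (1 - t))).symm.trans h).symm,
    hΦ, hΨ,
    fun t _ => ⟨Homeomorph.symm_apply_apply _, Homeomorph.apply_symm_apply _⟩,
    fun t _ => hD.compact_support _, fun t ht => ?_⟩
  obtain ⟨hnn, hgt⟩ := hginv t ht
  have hmap : ∀ i, (F (t / (1 - t))).symm.trans h (x i t) = q i := fun i => by
    have := hFX _ hnn i
    simp only [hgt] at this
    rw [Homeomorph.trans_apply, ← this, Homeomorph.symm_apply_apply, hhq]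
  rw [← hqr]
  ext w
  constructor
  · rintro ⟨_, ⟨i, rfl⟩, rfl⟩
    exact ⟨i, (hmap i).symm⟩
  · rintro ⟨i, rfl⟩
    exact ⟨_, ⟨i, rfl⟩, hmap i⟩
end

section
/- Let f : [a, b] → ℝ be continuous and suppose that the set of points of [a, b] at which f attains a local maximum or a local minimum (relative to [a, b]) is finite. Then for every q ∈ [a, b) there exists δ > 0 with q + δ ≤ b such that f is monotone (either nondecreasing or nonincreasing) on [q, q + δ]; likewise, for every q ∈ (a, b] there exists δ′ > 0 with q − δ′ ≥ a such that f is monotone on [q − δ′, q]. -/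
/-- A continuous function on `[c, d]` without local extrema in `(c, d)` is monotone or antitone. -/
theorem monotoneOn_or_antitoneOn_Icc_of_forall_not_isLocalExtr {c d : ℝ} {f : ℝ → ℝ}
    (hcd : c ≤ d) (hf : ContinuousOn f (Set.Icc c d))
    (hext : ∀ x ∈ Set.Ioo c d, ¬ IsLocalExtr f x) :
    MonotoneOn f (Set.Icc c d) ∨ AntitoneOn f (Set.Icc c d) := by
  have hne : ∀ x ∈ Set.Icc c d, ∀ y ∈ Set.Icc c d, x < y → f x ≠ f y := by
    intro x hx y hy hxy h
    obtain ⟨z, hz, hz'⟩ :=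
      exists_isLocalExtr_Ioo hxy (hf.mono (Set.Icc_subset_Icc hx.1 hy.2)) h
    exact hext z ⟨hx.1.trans_lt hz.1, hz.2.trans_le hy.2⟩ hz'
  have hinj : Set.InjOn f (Set.Icc c d) := by
    intro x hx y hy h
    rcases lt_trichotomy x y with hlt | heq | hgt
    · exact absurd h (hne x hx y hy hlt)
    · exact heq
    · exact absurd h.symm (hne y hy x hx hgt)
  exact (hf.strictMonoOn_of_injOn_Icc' hcd hinj).imp
    StrictMonoOn.monotoneOn StrictAntiOn.antitoneOn

/-- A finite set of reals has no points other than `q` within some positive distance of `q`. -/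
theorem Set.Finite.exists_pos_forall_abs_sub_lt_imp_eq {s : Set ℝ} (hs : s.Finite) (q : ℝ) :
    ∃ ε > 0, ∀ x ∈ s, |x - q| < ε → x = q := by
  have hnhds : (s \ {q})ᶜ ∈ nhds q :=
    (hs.subset Set.sdiff_subset).isClosed.isOpen_compl.mem_nhds (by simp)
  obtain ⟨ε, hε, hball⟩ := Metric.mem_nhds_iff.1 hnhds
  refine ⟨ε, hε, fun x hx hxq => ?_⟩
  by_contra hne
  exact hball (Metric.mem_ball.2 hxq) ⟨hx, hne⟩

/-- If `f : [a, b] → ℝ` is continuous and has only finitely many points of local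
maximum or local minimum relative to `[a, b]`, then `f` is monotone on a small
interval to the right of every point `q ∈ [a, b)` and on a small interval to the
left of every point `q ∈ (a, b]`. -/
theorem monotone_on_one_side (a b : ℝ) (hab : a ≤ b) (f : ℝ → ℝ)
    (hf : ContinuousOn f (Set.Icc a b))
    (hfin : {x ∈ Set.Icc a b |
        IsLocalMaxOn f (Set.Icc a b) x ∨ IsLocalMinOn f (Set.Icc a b) x}.Finite) :
    (∀ q ∈ Set.Ico a b, ∃ δ > (0 : ℝ), q + δ ≤ b ∧
      (MonotoneOn f (Set.Icc q (q + δ)) ∨ AntitoneOn f (Set.Icc q (q + δ)))) ∧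
    (∀ q ∈ Set.Ioc a b, ∃ δ > (0 : ℝ), a ≤ q - δ ∧
      (MonotoneOn f (Set.Icc (q - δ) q) ∨ AntitoneOn f (Set.Icc (q - δ) q))) := by
  have key : ∀ q c d : ℝ, ∀ ε : ℝ, a ≤ c → c ≤ d → d ≤ b →
      (∀ x ∈ Set.Ioo c d, |x - q| < ε ∧ x ≠ q) →
      (∀ x ∈ {x ∈ Set.Icc a b |
        IsLocalMaxOn f (Set.Icc a b) x ∨ IsLocalMinOn f (Set.Icc a b) x}, |x - q| < ε → x = q) →
      MonotoneOn f (Set.Icc c d) ∨ AntitoneOn f (Set.Icc c d) := by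
    intro q c d ε hac hcd hdb hx hε
    refine monotoneOn_or_antitoneOn_Icc_of_forall_not_isLocalExtr hcd
      (hf.mono (Set.Icc_subset_Icc hac hdb)) fun x hxcd hext => (hx x hxcd).2 ?_
    exact hε x ⟨⟨hac.trans hxcd.1.le, hxcd.2.le.trans hdb⟩,
      Or.symm hext |>.imp (IsLocalMax.on · _) (IsLocalMin.on · _)⟩ (hx x hxcd).1
  constructor <;> intro q hq <;>
    obtain ⟨ε, hε, hisol⟩ := hfin.exists_pos_forall_abs_sub_lt_imp_eq q
  · have h₁ := min_le_left ε (b - q)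
    have h₂ := min_le_right ε (b - q)
    have hpos : 0 < min ε (b - q) := lt_min hε (sub_pos.2 hq.2)
    refine ⟨min ε (b - q), hpos, by linarith,
      key q _ _ ε hq.1 (by linarith) (by linarith) (fun x hx => ⟨?_, hx.1.ne'⟩) hisol⟩
    rw [abs_lt]
    constructor <;> linarith [hx.1, hx.2]
  · have h₁ := min_le_left ε (q - a)
    have h₂ := min_le_right ε (q - a)
    have hpos : 0 < min ε (q - a) := lt_min hε (sub_pos.2 hq.1)
    refine ⟨min ε (q - a), hpos, by linarith,
      key q _ _ ε (by linarith) (by linarith) hq.2 (fun x hx => ⟨?_, hx.2.ne⟩) hisol⟩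
    rw [abs_lt]
    constructor <;> linarith [hx.1, hx.2]
end
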